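/- (Safety of the TDE pruning strategy.) Let D be a finite database of q-sequences, let t be a sequence, and let ξ ∈ ℝ be a threshold. If PEU(t) ≤ ξ, then every sequence t'' having t as a proper extension-prefix satisfies u(t'') ≤ ξ; hence no descendant of t can have utility exceeding ξ. -/

import Mathlib

open scoped Classical

namespace TKUS

variable {I : Type*} [Fintype I] [LinearOrder I]

/-- `p` is the (0-based) position list of an instance of the sequence `t`
in the q-sequence `s`. -/
def IsInstance (s : List (I →₀ ℕ)) (t : List (Finset I)) (p : List ℕ) : Prop :=
  p.length = t.length ∧ p.Chain' (· < ·) ∧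
    ∀ v < t.length, p.getD v 0 < s.length ∧
      ∀ i ∈ t.getD v ∅, 0 < s.getD (p.getD v 0) 0 i

/-- `t ⊑ s` : `t` has at least one instance in `s`. -/
def Contains (s : List (I →₀ ℕ)) (t : List (Finset I)) : Prop :=
  ∃ p, IsInstance s t p

/-- `u(t,p,s)` : utility of `t` at position `p` in `s`. -/
def uPos (eu : I → ℝ) (s : List (I →₀ ℕ)) (t : List (Finset I)) (p : List ℕ) : ℝ :=
  ∑ v ∈ Finset.range t.length, ∑ i ∈ t.getD v ∅,
    (s.getD (p.getD v 0) 0 i : ℝ) * eu i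

/-- `u(t,s)` : the maximum utility over all instances of `t` in `s` (`0` if none). -/
noncomputable def uSeq (eu : I → ℝ) (s : List (I →₀ ℕ)) (t : List (Finset I)) : ℝ :=
  sSup {x | ∃ p, IsInstance s t p ∧ x = uPos eu s t p}

/-- the greatest item of the last itemset of `t`, as an element of `WithBot I`. -/
def iLast (t : List (Finset I)) : WithBot I :=
  (t.getLast?.getD ∅).max

/-- `u_rest(t,k,s)` : remaining utility of `t` at extension position `k` in `s`. -/
def uRest (eu : I → ℝ) (s : List (I →₀ ℕ)) (t : List (Finset I)) (k : ℕ) : ℝ :=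
  ∑ j ∈ Finset.range s.length, ∑ i ∈ (s.getD j 0).support,
    if k < j ∨ (j = k ∧ iLast t < (i : WithBot I)) then (s.getD j 0 i : ℝ) * eu i else 0

/-- `k` is an extension position of `t` in `s`. -/
def ExtPos (s : List (I →₀ ℕ)) (t : List (Finset I)) (k : ℕ) : Prop :=
  ∃ p, IsInstance s t p ∧ p.getLast?.getD 0 = k

/-- the pivot : the least extension position of `t` in `s`. -/
noncomputable def pivot (s : List (I →₀ ℕ)) (t : List (Finset I)) : ℕ :=
  sInf {k | ExtPos s t k}

/-- `u_rest(t,s)` : remaining utility of `t` at the pivot. -/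
noncomputable def uRestSeq (eu : I → ℝ) (s : List (I →₀ ℕ)) (t : List (Finset I)) : ℝ :=
  uRest eu s t (pivot s t)

/-- `PEU(t,p,s)`. -/
noncomputable def PEUpos (eu : I → ℝ) (s : List (I →₀ ℕ)) (t : List (Finset I))
    (p : List ℕ) : ℝ :=
  if 0 < uRest eu s t (p.getLast?.getD 0) then
    uPos eu s t p + uRest eu s t (p.getLast?.getD 0)
  else 0

/-- `PEU(t,s)` : maximum of `PEU(t,p,s)` over all instances. -/
noncomputable def PEUseq (eu : I → ℝ) (s : List (I →₀ ℕ)) (t : List (Finset I)) : ℝ :=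
  sSup {x | ∃ p, IsInstance s t p ∧ x = PEUpos eu s t p}

/-- `t'` is an extension-prefix of `t` : `t' = ⟨X₁,…,X_{r−1}, X'_r⟩` where
`X'_r` is a nonempty lower segment of `X_r`. -/
def ExtPrefix (t' t : List (Finset I)) : Prop :=
  t' ≠ [] ∧ t'.length ≤ t.length ∧
    (∀ v, v + 1 < t'.length → t'.getD v ∅ = t.getD v ∅) ∧
    (t'.getD (t'.length - 1) ∅).Nonempty ∧
    t'.getD (t'.length - 1) ∅ ⊆ t.getD (t'.length - 1) ∅ ∧
    ∀ a ∈ t.getD (t'.length - 1) ∅ \ t'.getD (t'.length - 1) ∅,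
      ∀ b ∈ t'.getD (t'.length - 1) ∅, b < a

/-- `t'` is a proper extension-prefix of `t`. -/
def ProperExtPrefix (t' t : List (Finset I)) : Prop :=
  ExtPrefix t' t ∧ t' ≠ t

/-- the length (total number of item occurrences) of a sequence. -/
def seqLen (t : List (Finset I)) : ℕ :=
  (t.map Finset.card).sum

/-- remove the greatest item from a finite itemset. -/
def delMax (X : Finset I) : Finset I :=
  X.filter fun i => (i : WithBot I) ≠ X.max

/-- the parent of a sequence: delete the greatest item of the last itemset
(dropping that itemset entirely if it becomes empty). -/
def parent (t : List (Finset I)) : List (Finset I) :=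
  match t.getLast? with
  | none => []
  | some X => if delMax X = ∅ then t.dropLast else t.dropLast ++ [delMax X]

/-- `u(s)` : utility of a whole q-sequence. -/
def uQ (eu : I → ℝ) (s : List (I →₀ ℕ)) : ℝ :=
  ∑ j ∈ Finset.range s.length, ∑ i ∈ (s.getD j 0).support,
    (s.getD j 0 i : ℝ) * eu i

/-- `u(t)` : utility of `t` in a database `D`. -/
noncomputable def uDB (eu : I → ℝ) (D : Multiset (List (I →₀ ℕ)))
    (t : List (Finset I)) : ℝ :=
  (D.map fun s => if Contains s t then uSeq eu s t else 0).sum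

/-- `PEU(t)` over a database. -/
noncomputable def PEUDB (eu : I → ℝ) (D : Multiset (List (I →₀ ℕ)))
    (t : List (Finset I)) : ℝ :=
  (D.map fun s => if Contains s t then PEUseq eu s t else 0).sum

/-- `RSU(t,s)`. -/
noncomputable def RSUseq (eu : I → ℝ) (s : List (I →₀ ℕ)) (t : List (Finset I)) : ℝ :=
  if Contains s t then PEUseq eu s (parent t) else 0

/-- `RSU(t)` over a database. -/
noncomputable def RSUDB (eu : I → ℝ) (D : Multiset (List (I →₀ ℕ)))
    (t : List (Finset I)) : ℝ :=
  (D.map fun s => RSUseq eu s t).sum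

/-- `SWU(t)` over a database. -/
noncomputable def SWUDB (eu : I → ℝ) (D : Multiset (List (I →₀ ℕ)))
    (t : List (Finset I)) : ℝ :=
  (D.map fun s => if Contains s t then uQ eu s else 0).sum

/-- `SEU(t)` over a database. -/
noncomputable def SEUDB (eu : I → ℝ) (D : Multiset (List (I →₀ ℕ)))
    (t : List (Finset I)) : ℝ :=
  (D.map fun s => if Contains s t then uSeq eu s t + uRestSeq eu s t else 0).sum

/-- `t' ⊴ t` : `t'` is a subsequence of `t`. -/
def Subseq (t' t : List (Finset I)) : Prop :=
  ∃ p : List ℕ, p.length = t'.length ∧ p.Chain' (· < ·) ∧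
    ∀ v < t'.length, p.getD v 0 < t.length ∧ t'.getD v ∅ ⊆ t.getD (p.getD v 0) ∅

/-- `t` is a top-k HUSP with respect to the candidate set `C`. -/
def IsTopK (eu : I → ℝ) (D : Multiset (List (I →₀ ℕ))) (k : ℕ)
    (C : Finset (List (Finset I))) (t : List (Finset I)) : Prop :=
  t ∈ C ∧ (C.filter fun r => uDB eu D t < uDB eu D r).card < k

section ExtensionPrefix

omit [Fintype I]

omit [LinearOrder I] in
theorem IsInstance.getD_lt_getD {s : List (I →₀ ℕ)} {t : List (Finset I)} {p : List ℕ}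
    (h : IsInstance s t p) {v w : ℕ} (hvw : v < w) (hw : w < t.length) :
    p.getD v 0 < p.getD w 0 := by
  have hw' : w < p.length := h.1 ▸ hw
  have hp : p.Pairwise (· < ·) := List.isChain_iff_pairwise.1 h.2.1
  rw [List.getD_eq_getElem _ _ (hvw.trans hw'), List.getD_eq_getElem _ _ hw']
  exact List.pairwise_iff_getElem.1 hp v w _ hw' hvw

theorem getD_take_of_lt (p : List ℕ) {v r : ℕ} (h : v < r) :
    (p.take r).getD v 0 = p.getD v 0 := by
  simp [List.getD_eq_getElem?_getD, List.getElem?_take_of_lt h]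

theorem getLast?_getD_eq_getD {α : Type*} (l : List α) (a : α) :
    l.getLast?.getD a = l.getD (l.length - 1) a := by
  rw [List.getLast?_eq_getElem?, List.getD_eq_getElem?_getD]

omit [LinearOrder I] in
theorem getD_eq_empty_of_length_le {t : List (Finset I)} {v : ℕ} (h : t.length ≤ v) :
    t.getD v ∅ = ∅ :=
  List.getD_eq_default _ _ h

theorem ExtPrefix.getD_subset {t' t : List (Finset I)} (h : ExtPrefix t' t) (v : ℕ) :
    t'.getD v ∅ ⊆ t.getD v ∅ := by
  obtain ⟨-, -, heq, -, hsub, -⟩ := h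
  rcases lt_trichotomy (v + 1) t'.length with hv | hv | hv
  · rw [heq v hv]
  · rwa [← hv] at hsub
  · rw [getD_eq_empty_of_length_le (by omega)]
    exact Finset.empty_subset _

theorem ExtPrefix.length_pos {t' t : List (Finset I)} (h : ExtPrefix t' t) : 0 < t'.length :=
  List.length_pos_iff.2 h.1

theorem ExtPrefix.isInstance_take {s : List (I →₀ ℕ)} {t' t : List (Finset I)} {p : List ℕ}
    (h : ExtPrefix t' t) (hp : IsInstance s t p) :
    IsInstance s t' (p.take t'.length) := by
  refine ⟨?_, List.IsChain.take hp.2.1 _, fun v hv => ?_⟩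
  · rw [List.length_take, hp.1, min_eq_left h.2.1]
  · rw [getD_take_of_lt p hv]
    obtain ⟨hlt, hpos⟩ := hp.2.2 v (hv.trans_le h.2.1)
    exact ⟨hlt, fun i hi => hpos i (h.getD_subset v hi)⟩

theorem ExtPrefix.contains {s : List (I →₀ ℕ)} {t' t : List (Finset I)}
    (h : ExtPrefix t' t) (hc : Contains s t) : Contains s t' :=
  hc.imp' _ fun _ => h.isInstance_take

theorem ProperExtPrefix.exists_sdiff_nonempty {t' t : List (Finset I)}
    (ht : ∀ X ∈ t, X.Nonempty) (h : ProperExtPrefix t' t) :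
    ∃ v < t.length, (t.getD v ∅ \ t'.getD v ∅).Nonempty := by
  by_contra! hcon
  have hsub : ∀ v < t.length, t.getD v ∅ ⊆ t'.getD v ∅ := fun v hv =>
    Finset.sdiff_eq_empty_iff_subset.1 (hcon v hv)
  have hlen : t'.length = t.length := by
    refine h.1.2.1.antisymm (not_lt.1 fun hlt => ?_)
    have hempty := hsub _ hlt
    rw [getD_eq_empty_of_length_le le_rfl, List.getD_eq_getElem _ _ hlt] at hempty
    exact (ht _ (List.getElem_mem hlt)).ne_empty (Finset.subset_empty.1 hempty)
  refine h.2 (List.ext_getElem hlen fun v hv' hv => ?_)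
  have heq := (h.1.getD_subset v).antisymm (hsub v hv)
  rwa [List.getD_eq_getElem _ _ hv', List.getD_eq_getElem _ _ hv] at heq

section Utility

variable {eu : I → ℝ} (heu : ∀ i, 0 < eu i)

include heu

omit [LinearOrder I] in
theorem itemUtility_nonneg (Y : I →₀ ℕ) (i : I) : 0 ≤ (Y i : ℝ) * eu i :=
  mul_nonneg (Nat.cast_nonneg _) (heu i).le

omit [LinearOrder I] in
theorem uPos_nonneg (s : List (I →₀ ℕ)) (t : List (Finset I)) (p : List ℕ) :
    0 ≤ uPos eu s t p :=
  Finset.sum_nonneg fun _ _ => Finset.sum_nonneg fun _ _ => itemUtility_nonneg heu _ _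

theorem PEUpos_nonneg (s : List (I →₀ ℕ)) (t : List (Finset I)) (p : List ℕ) :
    0 ≤ PEUpos eu s t p := by
  unfold PEUpos
  split_ifs with h
  · exact add_nonneg (uPos_nonneg heu s t p) h.le
  · exact le_rfl

theorem PEUseq_nonneg (s : List (I →₀ ℕ)) (t : List (Finset I)) : 0 ≤ PEUseq eu s t := by
  refine Real.sSup_nonneg ?_
  rintro _ ⟨p, -, rfl⟩
  exact PEUpos_nonneg heu s t p

omit [LinearOrder I] heu in
theorem finite_setOf_isInstance (s : List (I →₀ ℕ)) (t : List (Finset I)) :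
    {p | IsInstance s t p}.Finite := by
  refine ((List.finite_length_eq (Fin s.length) t.length).image
    (List.map Fin.val)).subset fun p hp => ?_
  have hlt : ∀ k ∈ p, k < s.length := fun k hk => by
    obtain ⟨v, hv, rfl⟩ := List.mem_iff_getElem.1 hk
    have := (hp.2.2 v (hp.1 ▸ hv)).1
    rwa [List.getD_eq_getElem _ _ hv] at this
  lift p to List (Fin s.length) using hlt
  exact ⟨p, by simpa using hp.1, rfl⟩

omit heu in
theorem le_PEUseq {s : List (I →₀ ℕ)} {t : List (Finset I)} {p : List ℕ}
    (hp : IsInstance s t p) : PEUpos eu s t p ≤ PEUseq eu s t := by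
  refine le_csSup (Set.Finite.bddAbove ?_) ⟨p, hp, rfl⟩
  refine ((finite_setOf_isInstance s t).image (PEUpos eu s t)).subset ?_
  rintro _ ⟨q, hq, rfl⟩
  exact ⟨q, hq, rfl⟩

omit heu in
theorem ExtPrefix.uPos_eq_add {t' t : List (Finset I)} (h : ExtPrefix t' t)
    (s : List (I →₀ ℕ)) (p : List ℕ) :
    uPos eu s t p = uPos eu s t' (p.take t'.length) +
      ∑ v ∈ Finset.range t.length, ∑ i ∈ t.getD v ∅ \ t'.getD v ∅,
        (s.getD (p.getD v 0) 0 i : ℝ) * eu i := by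
  have hprefix : uPos eu s t' (p.take t'.length) =
      ∑ v ∈ Finset.range t.length, ∑ i ∈ t'.getD v ∅,
        (s.getD (p.getD v 0) 0 i : ℝ) * eu i := by
    rw [← Finset.sum_subset (Finset.range_mono h.2.1) fun v _ hv => by
      rw [getD_eq_empty_of_length_le (not_lt.1 (mt Finset.mem_range.2 hv)), Finset.sum_empty]]
    refine Finset.sum_congr rfl fun v hv => ?_
    rw [getD_take_of_lt p (Finset.mem_range.1 hv)]
  rw [hprefix, ← Finset.sum_add_distrib]
  refine Finset.sum_congr rfl fun v _ => ?_
  rw [add_comm, Finset.sum_sdiff (h.getD_subset v)]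

omit heu in
theorem ExtPrefix.iLast_lt {t' t : List (Finset I)} (h : ExtPrefix t' t) {i : I}
    (hi : i ∈ t.getD (t'.length - 1) ∅ \ t'.getD (t'.length - 1) ∅) :
    iLast t' < (i : WithBot I) := by
  rw [iLast, getLast?_getD_eq_getD, Finset.max_eq_sup_withBot,
    Finset.sup_lt_iff (WithBot.bot_lt_coe i)]
  exact fun b hb => WithBot.coe_lt_coe.2 (h.2.2.2.2.2 i hi b hb)

omit heu in
theorem ExtPrefix.occurs_after {s : List (I →₀ ℕ)} {t' t : List (Finset I)} {p : List ℕ}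
    (h : ExtPrefix t' t) (hp : IsInstance s t p) {v : ℕ} (hv : v < t.length) {i : I}
    (hi : i ∈ t.getD v ∅ \ t'.getD v ∅) :
    (p.take t'.length).getLast?.getD 0 < p.getD v 0 ∨
      p.getD v 0 = (p.take t'.length).getLast?.getD 0 ∧ iLast t' < (i : WithBot I) := by
  have hpos := h.length_pos
  have hlast : (p.take t'.length).getLast?.getD 0 = p.getD (t'.length - 1) 0 := by
    rw [getLast?_getD_eq_getD, (h.isInstance_take hp).1, getD_take_of_lt p (by omega)]
  rw [hlast]
  rcases lt_trichotomy v (t'.length - 1) with hlt | rfl | hgt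
  · rw [h.2.2.1 v (by omega), Finset.sdiff_self] at hi
    exact absurd hi (Finset.notMem_empty i)
  · exact Or.inr ⟨rfl, h.iLast_lt hi⟩
  · exact Or.inl (hp.getD_lt_getD hgt hv)

theorem ExtPrefix.sum_sdiff_le_uRest {s : List (I →₀ ℕ)} {t' t : List (Finset I)} {p : List ℕ}
    (h : ExtPrefix t' t) (hp : IsInstance s t p) :
    ∑ v ∈ Finset.range t.length, ∑ i ∈ t.getD v ∅ \ t'.getD v ∅,
        (s.getD (p.getD v 0) 0 i : ℝ) * eu i ≤
      uRest eu s t' ((p.take t'.length).getLast?.getD 0) := by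
  set k := (p.take t'.length).getLast?.getD 0 with hk
  set G : ℕ → ℝ := fun j => ∑ i ∈ (s.getD j 0).support,
    if k < j ∨ (j = k ∧ iLast t' < (i : WithBot I)) then (s.getD j 0 i : ℝ) * eu i else 0 with hG
  have hterm : ∀ (j : ℕ) (i : I), 0 ≤ if k < j ∨ (j = k ∧ iLast t' < (i : WithBot I)) then
      (s.getD j 0 i : ℝ) * eu i else 0 := fun j i => by
    split_ifs
    exacts [itemUtility_nonneg heu _ _, le_rfl]
  have hinj : Set.InjOn (fun v => p.getD v 0) (Finset.range t.length) := by
    refine StrictMonoOn.injOn fun v _ w hw hvw => hp.getD_lt_getD hvw ?_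
    simpa using hw
  calc _ ≤ ∑ v ∈ Finset.range t.length, G (p.getD v 0) := by
        refine Finset.sum_le_sum fun v hv => ?_
        have hv' := Finset.mem_range.1 hv
        refine (Finset.sum_congr rfl fun i hi => ?_).trans_le
          (Finset.sum_le_sum_of_subset_of_nonneg (fun i hi => ?_) fun i _ _ => hterm _ i)
        · rw [if_pos (h.occurs_after hp hv' hi)]
        · exact Finsupp.mem_support_iff.2 ((hp.2.2 v hv').2 i (Finset.mem_sdiff.1 hi).1).ne'
    _ = ∑ j ∈ (Finset.range t.length).image (fun v => p.getD v 0), G j :=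
        (Finset.sum_image hinj).symm
    _ ≤ ∑ j ∈ Finset.range s.length, G j := by
        refine Finset.sum_le_sum_of_subset_of_nonneg ?_ fun j _ _ =>
          Finset.sum_nonneg fun i _ => hterm j i
        refine Finset.image_subset_iff.2 fun v hv => ?_
        exact Finset.mem_range.2 (hp.2.2 v (Finset.mem_range.1 hv)).1

theorem ProperExtPrefix.sum_sdiff_pos {s : List (I →₀ ℕ)} {t' t : List (Finset I)} {p : List ℕ}
    (ht : ∀ X ∈ t, X.Nonempty) (h : ProperExtPrefix t' t) (hp : IsInstance s t p) :
    0 < ∑ v ∈ Finset.range t.length, ∑ i ∈ t.getD v ∅ \ t'.getD v ∅,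
        (s.getD (p.getD v 0) 0 i : ℝ) * eu i := by
  obtain ⟨v, hv, hne⟩ := h.exists_sdiff_nonempty ht
  refine Finset.sum_pos' (fun _ _ => Finset.sum_nonneg fun _ _ => itemUtility_nonneg heu _ _)
    ⟨v, Finset.mem_range.2 hv, Finset.sum_pos (fun i hi => ?_) hne⟩
  exact mul_pos (Nat.cast_pos.2 ((hp.2.2 v hv).2 i (Finset.mem_sdiff.1 hi).1)) (heu i)

theorem ProperExtPrefix.uPos_le_PEUpos {s : List (I →₀ ℕ)} {t' t : List (Finset I)} {p : List ℕ}
    (ht : ∀ X ∈ t, X.Nonempty) (h : ProperExtPrefix t' t) (hp : IsInstance s t p) :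
    uPos eu s t p ≤ PEUpos eu s t' (p.take t'.length) := by
  have hle := h.1.sum_sdiff_le_uRest heu hp
  rw [PEUpos, if_pos ((h.sum_sdiff_pos heu ht hp).trans_le hle), h.1.uPos_eq_add s p]
  exact add_le_add_right hle _

theorem ProperExtPrefix.uSeq_le_PEUseq {t' t : List (Finset I)} (ht : ∀ X ∈ t, X.Nonempty)
    (h : ProperExtPrefix t' t) (s : List (I →₀ ℕ)) : uSeq eu s t ≤ PEUseq eu s t' := by
  refine Real.sSup_le ?_ (PEUseq_nonneg heu s t')
  rintro _ ⟨p, hp, rfl⟩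
  exact (h.uPos_le_PEUpos heu ht hp).trans (le_PEUseq (h.1.isInstance_take hp))

theorem ProperExtPrefix.uDB_le_PEUDB {t' t : List (Finset I)} (ht : ∀ X ∈ t, X.Nonempty)
    (h : ProperExtPrefix t' t) (D : Multiset (List (I →₀ ℕ))) : uDB eu D t ≤ PEUDB eu D t' := by
  refine Multiset.sum_map_le_sum_map _ _ fun s _ => ?_
  by_cases hc : Contains s t
  · rw [if_pos hc, if_pos (h.1.contains hc)]
    exact h.uSeq_le_PEUseq heu ht s
  · rw [if_neg hc]
    split_ifs
    exacts [PEUseq_nonneg heu s t', le_rfl]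

end Utility

end ExtensionPrefix

/-- safety of the TDE pruning strategy: if `PEU(t) ≤ ξ` then every
sequence `t''` having `t` as a proper extension-prefix satisfies `u(t'') ≤ ξ`. -/
theorem TDE_safe
    (eu : I → ℝ) (heu : ∀ i, 0 < eu i)
    (D : Multiset (List (I →₀ ℕ)))
    (t : List (Finset I)) (ht : ∀ X ∈ t, X.Nonempty)
    (ξ : ℝ) (hpeu : PEUDB eu D t ≤ ξ) :
    ∀ t'' : List (Finset I), (∀ X ∈ t'', X.Nonempty) →
      ProperExtPrefix t t'' → uDB eu D t'' ≤ ξ := by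
  exact fun _ ht'' h => (h.uDB_le_PEUDB heu ht'' D).trans hpeu

end TKUS
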